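/- Let 𝔡_00 = { x ∈ ℓ∞ : lim_{n→∞} |{k ≤ n : x(k) ≠ 0}| / n = 0 } and 𝔡_0 = { x ∈ ℓ∞ : for every ε > 0, lim_{n→∞} |{k ≤ n : |x(k)| ≥ ε}| / n = 0 }. Then: (1) 𝔡_00 is an ideal of ℓ∞ and 𝔡_0 is a closed ideal of ℓ∞; (2) 𝔡_00 is dense in 𝔡_0; (3) neither 𝔡_00 nor 𝔡_0 has a multiplicative unit; (4) setting D = ⋃{ cl_{βℕ}A : A ⊆ ℕ and lim_{n→∞} |A ∩ {1,…,n}| / n = 0 } ⊆ βℕ, the set D is open in βℕ, contains ℕ as a dense subspace, is not compact, and 𝔡_00 and 𝔡_0 are isometrically isomorphic to C_00(D) and C_0(D), respectively. -/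

import Mathlib

open Set Filter Topology BoundedContinuousFunction

noncomputable section

/-- `A ⊆ ℕ` has asymptotic density zero: `|A ∩ {1,…,n}| / n → 0`. -/
def DensityZero (A : Set ℕ) : Prop :=
  Filter.Tendsto (fun n : ℕ => (Nat.card ↥(A ∩ Set.Icc 1 n) : ℝ) / n)
    Filter.atTop (nhds 0)

/-- The ideal `𝔡_00` in `ℓ∞ = C_B(ℕ)`. -/
def d00 : Set (ℕ →ᵇ ℂ) :=
  {x | DensityZero {k : ℕ | x k ≠ 0}}

/-- The ideal `𝔡_0` in `ℓ∞ = C_B(ℕ)`. -/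
def d0 : Set (ℕ →ᵇ ℂ) :=
  {x | ∀ ε : ℝ, 0 < ε → DensityZero {k : ℕ | ε ≤ ‖x k‖}}

/-- The subspace `D` of `βℕ`. -/
def Dset : Set (StoneCech ℕ) :=
  ⋃ A ∈ {A : Set ℕ | DensityZero A}, closure (stoneCechUnit '' A)

namespace DensityZero

theorem mono {A B : Set ℕ} (hB : DensityZero B) (h : A ⊆ B) : DensityZero A := by
  refine squeeze_zero (fun n => by positivity) (fun n => ?_) hB
  gcongr
  exact Nat.card_mono ((finite_Icc 1 n).inter_of_right B) (inter_subset_inter_left _ h)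

theorem union {A B : Set ℕ} (hA : DensityZero A) (hB : DensityZero B) :
    DensityZero (A ∪ B) := by
  have hAB := Filter.Tendsto.add hA hB
  rw [add_zero] at hAB
  refine squeeze_zero (fun n => by positivity) (fun n => ?_) hAB
  rw [← add_div, union_inter_distrib_right]
  gcongr
  exact_mod_cast Set.ncard_union_le (A ∩ Icc 1 n) (B ∩ Icc 1 n)

theorem of_finite {A : Set ℕ} (hA : A.Finite) : DensityZero A := by
  refine squeeze_zero (fun n => by positivity) (fun n => ?_)
    (tendsto_const_div_atTop_nhds_zero_nat (Nat.card A : ℝ))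
  gcongr
  exact Nat.card_mono hA inter_subset_left

theorem empty : DensityZero ∅ := of_finite finite_empty

theorem not_univ : ¬ DensityZero univ := by
  intro h
  have h1 : Tendsto (fun n : ℕ => (Nat.card ↥(univ ∩ Icc 1 n) : ℝ) / n) atTop (𝓝 1) := by
    refine tendsto_const_nhds.congr' ?_
    filter_upwards [eventually_gt_atTop 0] with n hn
    have : (n : ℝ) ≠ 0 := by positivity
    simp [this]
  exact zero_ne_one (tendsto_nhds_unique h h1)

end DensityZero

theorem d00_subset_d0 : d00 ⊆ d0 := fun x hx ε hε =>
  DensityZero.mono hx fun k (hk : ε ≤ ‖x k‖) => norm_pos_iff.1 (hε.trans_le hk)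

/-- The set `d00` as an ideal. -/
def d00Ideal : Ideal (ℕ →ᵇ ℂ) where
  carrier := d00
  zero_mem' := by simpa [d00] using DensityZero.empty
  add_mem' {x y} hx hy := by
    refine DensityZero.mono (DensityZero.union hx hy) fun k (hk : x k + y k ≠ 0) => ?_
    by_contra! h
    simp_all
  smul_mem' c x hx := DensityZero.mono hx fun k (hk : c k * x k ≠ 0) => right_ne_zero_of_mul hk

/-- The set `d0` as an ideal. -/
def d0Ideal : Ideal (ℕ →ᵇ ℂ) where
  carrier := d0
  zero_mem' := d00_subset_d0 d00Ideal.zero_mem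
  add_mem' {x y} hx hy ε hε := by
    refine DensityZero.mono (DensityZero.union (hx (ε / 2) (half_pos hε)) (hy (ε / 2) (half_pos hε)))
      fun k (hk : ε ≤ ‖x k + y k‖) => ?_
    by_contra! h
    simp only [mem_union, mem_ofPred_eq, not_or, not_le] at h
    linarith [norm_add_le (x k) (y k)]
  smul_mem' c x hx ε hε := by
    have hc : 0 < ‖c‖ + 1 := by positivity
    refine DensityZero.mono (hx (ε / (‖c‖ + 1)) (by positivity))
      fun k (hk : ε ≤ ‖c k * x k‖) => ?_
    rw [mem_ofPred_eq, div_le_iff₀' hc]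
    rw [norm_mul] at hk
    refine hk.trans ?_
    gcongr
    linarith [c.norm_coe_le_norm k]

theorem isClosed_d0 : IsClosed d0 := by
  refine isClosed_of_closure_subset fun x hx ε hε => ?_
  obtain ⟨y, hy, hxy⟩ := Metric.mem_closure_iff.1 hx (ε / 2) (half_pos hε)
  refine DensityZero.mono (hy (ε / 2) (half_pos hε)) fun k (hk : ε ≤ ‖x k‖) => ?_
  have h1 : ‖x k - y k‖ < ε / 2 := by
    rw [← dist_eq_norm]
    exact (dist_coe_le_dist k).trans_lt hxy
  have h2 := norm_sub_norm_le (x k) (y k)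
  rw [mem_ofPred_eq]
  linarith

theorem d0_subset_closure_d00 : d0 ⊆ closure d00 := by
  classical
  intro x hx
  refine Metric.mem_closure_iff.2 fun ε hε => ?_
  let y : ℕ →ᵇ ℂ := ofNormedAddCommGroupDiscrete (fun k => if ε / 2 ≤ ‖x k‖ then x k else 0) ‖x‖
    fun k => by
      split_ifs
      · exact x.norm_coe_le_norm k
      · simp
  have hy : ∀ k, y k = if ε / 2 ≤ ‖x k‖ then x k else 0 := fun k => rfl
  refine ⟨y, DensityZero.mono (hx (ε / 2) (half_pos hε)) fun k (hk : y k ≠ 0) => ?_, ?_⟩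
  · by_contra h
    exact hk ((hy k).trans (if_neg h))
  · refine lt_of_le_of_lt ((dist_le (half_pos hε).le).2 fun k => ?_) (half_lt_self hε)
    rw [hy, dist_eq_norm]
    split_ifs with h
    · simpa using (half_pos hε).le
    · simpa using (not_le.1 h).le

/-- The indicator function of a singleton. -/
def singletonIndicator (n : ℕ) : ℕ →ᵇ ℂ :=
  ofNormedAddCommGroupDiscrete (Pi.single n 1) 1 fun k => by
    by_cases h : k = n
    · subst h; simp
    · simp [h]

theorem singletonIndicator_mem_d00 (n : ℕ) : singletonIndicator n ∈ d00 := by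
  refine DensityZero.mono (DensityZero.of_finite (finite_singleton n)) fun k hk => ?_
  by_contra h
  exact hk (Pi.single_eq_of_ne h _)

theorem eq_one_of_mul_singletonIndicator {u : ℕ →ᵇ ℂ}
    (hu : ∀ n, u * singletonIndicator n = singletonIndicator n) : u = 1 := by
  ext n
  have h : u n * singletonIndicator n n = singletonIndicator n n :=
    DFunLike.congr_fun (hu n) n
  simpa [singletonIndicator] using h

theorem one_notMem_d0 : (1 : ℕ →ᵇ ℂ) ∉ d0 := fun h =>
  DensityZero.not_univ ((h 1 one_pos).mono fun k _ => by simp)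

theorem IsOpen.subset_closure_image_stoneCechUnit {U : Set (StoneCech ℕ)} (hU : IsOpen U) :
    U ⊆ closure (stoneCechUnit '' (stoneCechUnit ⁻¹' U)) := by
  rw [image_preimage_eq_inter_range]
  exact denseRange_stoneCechUnit.open_subset_closure_inter hU

theorem exists_isClopen_preimage_stoneCechUnit (A : Set ℕ) :
    ∃ U : Set (StoneCech ℕ), IsClopen U ∧ stoneCechUnit ⁻¹' U = A := by
  classical
  have hc : Continuous fun n : ℕ => decide (n ∈ A) := continuous_of_discreteTopology
  refine ⟨stoneCechExtend hc ⁻¹' {true},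
    (isClopen_discrete _).preimage (continuous_stoneCechExtend hc), ?_⟩
  ext n
  simp [stoneCechExtend_stoneCechUnit]

theorem isClopen_closure_image_stoneCechUnit (A : Set ℕ) :
    IsClopen (closure (stoneCechUnit '' A)) ∧
      stoneCechUnit ⁻¹' closure (stoneCechUnit '' A) = A := by
  obtain ⟨U, hU, rfl⟩ := exists_isClopen_preimage_stoneCechUnit A
  have h : closure (stoneCechUnit '' (stoneCechUnit ⁻¹' U)) = U :=
    (closure_minimal (image_preimage_subset _ _) hU.1).antisymm
      hU.2.subset_closure_image_stoneCechUnit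
  rw [h]
  exact ⟨hU, rfl⟩

theorem closure_subset_Dset {A : Set ℕ} (hA : DensityZero A) :
    closure (stoneCechUnit '' A) ⊆ Dset :=
  subset_biUnion_of_mem (u := fun A : Set ℕ => closure (stoneCechUnit '' A)) hA

theorem isOpen_Dset : IsOpen Dset :=
  isOpen_biUnion fun A _ => (isClopen_closure_image_stoneCechUnit A).1.isOpen

theorem stoneCechUnit_mem_Dset (n : ℕ) : stoneCechUnit n ∈ Dset :=
  closure_subset_Dset (DensityZero.of_finite (finite_singleton n))
    (subset_closure (mem_image_of_mem _ rfl))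

theorem exists_densityZero_of_isCompact {K : Set (StoneCech ℕ)} (hK : IsCompact K)
    (h : K ⊆ Dset) : ∃ A, DensityZero A ∧ K ⊆ closure (stoneCechUnit '' A) := by
  have : Nonempty {A : Set ℕ // DensityZero A} := ⟨⟨∅, DensityZero.empty⟩⟩
  obtain ⟨A, hA⟩ := hK.elim_directed_cover
    (fun A : {A : Set ℕ // DensityZero A} => closure (stoneCechUnit '' (A : Set ℕ)))
    (fun A => (isClopen_closure_image_stoneCechUnit A).1.isOpen)
    (by rwa [Dset, biUnion_eq_iUnion] at h)
    (fun A B => ⟨⟨A ∪ B, A.2.union B.2⟩,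
      closure_mono (image_mono subset_union_left),
      closure_mono (image_mono subset_union_right)⟩)
  exact ⟨A, A.2, hA⟩

theorem densityZero_preimage_of_isCompact {K : Set (StoneCech ℕ)} (hK : IsCompact K)
    (h : K ⊆ Dset) : DensityZero (stoneCechUnit ⁻¹' K) := by
  obtain ⟨A, hA, hKA⟩ := exists_densityZero_of_isCompact hK h
  refine hA.mono ?_
  rw [← (isClopen_closure_image_stoneCechUnit A).2]
  exact preimage_mono hKA

theorem not_isCompact_Dset : ¬ IsCompact Dset := fun h =>
  DensityZero.not_univ
    ((densityZero_preimage_of_isCompact h Subset.rfl).mono fun n _ => stoneCechUnit_mem_Dset n)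

/-- The canonical map `ℕ → Dset`. -/
def toDset (n : ℕ) : Dset := ⟨stoneCechUnit n, stoneCechUnit_mem_Dset n⟩

theorem denseRange_toDset : DenseRange toDset := by
  rw [DenseRange, Subtype.dense_iff, ← range_comp]
  exact fun x _ => denseRange_stoneCechUnit x

theorem densityZero_preimage_toDset {K : Set Dset} (hK : IsCompact K) :
    DensityZero (toDset ⁻¹' K) := by
  refine (densityZero_preimage_of_isCompact (hK.image continuous_subtype_val)
    (by rintro _ ⟨x, -, rfl⟩; exact x.2)).mono fun n hn => ?_
  exact ⟨toDset n, hn, rfl⟩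

theorem isCompact_preimage_closure {A : Set ℕ} (hA : DensityZero A) :
    IsCompact ((↑) ⁻¹' closure (stoneCechUnit '' A) : Set Dset) :=
  IsInducing.subtypeVal.isCompact_preimage' isClosed_closure.isCompact
    (by simpa using closure_subset_Dset hA)

theorem exists_extend_stoneCech (f : ℕ →ᵇ ℂ) :
    ∃ F : StoneCech ℕ →ᵇ ℂ, ∀ n, F (stoneCechUnit n) = f n := by
  have hc : Continuous fun n : ℕ =>
      (⟨f n, mem_closedBall_zero_iff.2 (f.norm_coe_le_norm n)⟩ : Metric.closedBall (0 : ℂ) ‖f‖) :=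
    continuous_of_discreteTopology
  have : CompactSpace (Metric.closedBall (0 : ℂ) ‖f‖) :=
    isCompact_iff_compactSpace.1 (isCompact_closedBall _ _)
  refine ⟨mkOfCompact ⟨fun x => (stoneCechExtend hc x).1,
    continuous_subtype_val.comp (continuous_stoneCechExtend hc)⟩, fun n => ?_⟩
  simp [stoneCechExtend_stoneCechUnit]

/-- The extension of a bounded sequence to `βℕ`. -/
def extendStoneCech (f : ℕ →ᵇ ℂ) : StoneCech ℕ →ᵇ ℂ := (exists_extend_stoneCech f).choose

theorem extendStoneCech_stoneCechUnit (f : ℕ →ᵇ ℂ) (n : ℕ) :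
    extendStoneCech f (stoneCechUnit n) = f n :=
  (exists_extend_stoneCech f).choose_spec n

/-- The extension of a bounded sequence to `Dset`. -/
def extendDset (f : ℕ →ᵇ ℂ) : Dset →ᵇ ℂ := (extendStoneCech f).domRestrict Dset

theorem extendDset_toDset (f : ℕ →ᵇ ℂ) (n : ℕ) : extendDset f (toDset n) = f n :=
  extendStoneCech_stoneCechUnit f n

theorem eq_of_forall_toDset {F G : Dset →ᵇ ℂ} (h : ∀ n, F (toDset n) = G (toDset n)) : F = G :=
  DFunLike.coe_injective (denseRange_toDset.equalizer F.continuous G.continuous (funext h))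

theorem extendDset_injective : Function.Injective extendDset := fun f g h => by
  ext n
  rw [← extendDset_toDset f, h, extendDset_toDset]

theorem extendDset_add (f g : ℕ →ᵇ ℂ) : extendDset (f + g) = extendDset f + extendDset g :=
  eq_of_forall_toDset fun n => by simp [extendDset_toDset]

theorem extendDset_mul (f g : ℕ →ᵇ ℂ) : extendDset (f * g) = extendDset f * extendDset g :=
  eq_of_forall_toDset fun n => by simp [extendDset_toDset]

theorem extendDset_smul (c : ℂ) (f : ℕ →ᵇ ℂ) : extendDset (c • f) = c • extendDset f :=
  eq_of_forall_toDset fun n => by simp [extendDset_toDset]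

theorem norm_extendDset (f : ℕ →ᵇ ℂ) : ‖extendDset f‖ = ‖f‖ := by
  apply le_antisymm
  · refine (norm_le (norm_nonneg _)).2 fun x => ?_
    refine denseRange_toDset.induction_on x
      (isClosed_le (extendDset f).continuous.norm continuous_const) fun n => ?_
    rw [extendDset_toDset]
    exact f.norm_coe_le_norm n
  · refine (norm_le (norm_nonneg _)).2 fun n => ?_
    rw [← extendDset_toDset]
    exact norm_coe_le_norm _ _

theorem exists_extendDset_eq (g : Dset →ᵇ ℂ) :
    ∃ f : ℕ →ᵇ ℂ, (∀ n, f n = g (toDset n)) ∧ extendDset f = g := by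
  let f : ℕ →ᵇ ℂ := g.compContinuous ⟨toDset, continuous_of_discreteTopology⟩
  exact ⟨f, fun n => rfl, eq_of_forall_toDset fun n => extendDset_toDset f n⟩

theorem norm_extendStoneCech_le {f : ℕ →ᵇ ℂ} {r : ℝ} {x : StoneCech ℕ}
    (hx : x ∉ closure (stoneCechUnit '' {k | r < ‖f k‖})) : ‖extendStoneCech f x‖ ≤ r := by
  by_contra! h
  have hU : IsOpen {y | r < ‖extendStoneCech f y‖} :=
    isOpen_lt continuous_const (extendStoneCech f).continuous.norm
  have := hU.subset_closure_image_stoneCechUnit h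
  simp only [preimage_ofPred_eq, extendStoneCech_stoneCechUnit] at this
  exact hx this

theorem hasCompactSupport_extendDset {f : ℕ →ᵇ ℂ} (hf : f ∈ d00) :
    HasCompactSupport (extendDset f) := by
  refine HasCompactSupport.intro (isCompact_preimage_closure hf) fun x hx => ?_
  refine norm_le_zero_iff.1 (norm_extendStoneCech_le (f := f) (x := x) ?_)
  simpa using hx

theorem exists_mem_d00_of_hasCompactSupport {g : Dset →ᵇ ℂ} (hg : HasCompactSupport g) :
    ∃ f ∈ d00, extendDset f = g := by
  obtain ⟨f, hf, hfg⟩ := exists_extendDset_eq g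
  refine ⟨f, (densityZero_preimage_toDset hg).mono fun n (hn : f n ≠ 0) => ?_, hfg⟩
  rw [hf] at hn
  exact subset_tsupport _ hn

theorem tendsto_extendDset {f : ℕ →ᵇ ℂ} (hf : f ∈ d0) :
    Tendsto (extendDset f) (cocompact Dset) (𝓝 0) := by
  refine Metric.tendsto_nhds.2 fun ε hε => ?_
  have hA : DensityZero {k | ε / 2 < ‖f k‖} :=
    (hf (ε / 2) (half_pos hε)).mono fun k (hk : ε / 2 < ‖f k‖) => hk.le
  filter_upwards [(isCompact_preimage_closure hA).compl_mem_cocompact] with x hx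
  rw [dist_zero_right]
  exact (norm_extendStoneCech_le (f := f) (x := x) hx).trans_lt (half_lt_self hε)

theorem exists_mem_d0_of_tendsto {g : Dset →ᵇ ℂ} (hg : Tendsto g (cocompact Dset) (𝓝 0)) :
    ∃ f ∈ d0, extendDset f = g := by
  obtain ⟨f, hf, hfg⟩ := exists_extendDset_eq g
  refine ⟨f, fun ε hε => ?_, hfg⟩
  obtain ⟨K, hK, hKg⟩ := mem_cocompact.1 (Metric.tendsto_nhds.1 hg ε hε)
  refine (densityZero_preimage_toDset hK).mono fun n (hn : ε ≤ ‖f n‖) => ?_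
  by_contra h
  have hlt : dist (g (toDset n)) 0 < ε := hKg h
  rw [dist_zero_right, ← hf] at hlt
  exact hlt.not_ge hn

theorem stmt_6 :
    -- (1) `𝔡_00` is an ideal of `ℓ∞` and `𝔡_0` is a closed ideal of `ℓ∞`
    ((∃ I : Ideal (ℕ →ᵇ ℂ), (I : Set (ℕ →ᵇ ℂ)) = d00) ∧
      (∃ I : Ideal (ℕ →ᵇ ℂ), (I : Set (ℕ →ᵇ ℂ)) = d0) ∧ IsClosed d0) ∧
    -- (2) `𝔡_00` is dense in `𝔡_0`
    (d00 ⊆ d0 ∧ d0 ⊆ closure d00) ∧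
    -- (3) neither `𝔡_00` nor `𝔡_0` has a multiplicative unit
    ((¬ ∃ u ∈ d00, ∀ f ∈ d00, u * f = f) ∧ ¬ ∃ u ∈ d0, ∀ f ∈ d0, u * f = f) ∧
    -- (4) `D` is open in `βℕ`, contains `ℕ` densely, is not compact, and
    --     `𝔡_00 ≅ C_00(D)` and `𝔡_0 ≅ C_0(D)` isometrically
    (IsOpen Dset ∧
      Set.range (stoneCechUnit : ℕ → StoneCech ℕ) ⊆ Dset ∧
      Dense {y : ↥Dset |
        (y : StoneCech ℕ) ∈ Set.range (stoneCechUnit : ℕ → StoneCech ℕ)} ∧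
      ¬ IsCompact Dset ∧
      (∃ Φ : (ℕ →ᵇ ℂ) → (↥Dset →ᵇ ℂ),
        (∀ f ∈ d00, HasCompactSupport (Φ f : ↥Dset → ℂ)) ∧
        (∀ g : ↥Dset →ᵇ ℂ, HasCompactSupport (g : ↥Dset → ℂ) → ∃ f ∈ d00, Φ f = g) ∧
        (∀ f ∈ d00, ∀ g ∈ d00, Φ f = Φ g → f = g) ∧
        (∀ f ∈ d00, ∀ g ∈ d00, Φ (f + g) = Φ f + Φ g) ∧
        (∀ f ∈ d00, ∀ g ∈ d00, Φ (f * g) = Φ f * Φ g) ∧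
        (∀ (c : ℂ), ∀ f ∈ d00, Φ (c • f) = c • Φ f) ∧
        (∀ f ∈ d00, ‖Φ f‖ = ‖f‖)) ∧
      (∃ Ψ : (ℕ →ᵇ ℂ) → (↥Dset →ᵇ ℂ),
        (∀ f ∈ d0, Filter.Tendsto (Ψ f : ↥Dset → ℂ) (Filter.cocompact _) (nhds 0)) ∧
        (∀ g : ↥Dset →ᵇ ℂ, Filter.Tendsto (g : ↥Dset → ℂ) (Filter.cocompact _) (nhds 0) →
          ∃ f ∈ d0, Ψ f = g) ∧
        (∀ f ∈ d0, ∀ g ∈ d0, Ψ f = Ψ g → f = g) ∧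
        (∀ f ∈ d0, ∀ g ∈ d0, Ψ (f + g) = Ψ f + Ψ g) ∧
        (∀ f ∈ d0, ∀ g ∈ d0, Ψ (f * g) = Ψ f * Ψ g) ∧
        (∀ (c : ℂ), ∀ f ∈ d0, Ψ (c • f) = c • Ψ f) ∧
        (∀ f ∈ d0, ‖Ψ f‖ = ‖f‖))) := by
  refine ⟨⟨⟨d00Ideal, rfl⟩, ⟨d0Ideal, rfl⟩, isClosed_d0⟩, ⟨d00_subset_d0, d0_subset_closure_d00⟩,
    ⟨?_, ?_⟩, isOpen_Dset, range_subset_iff.2 stoneCechUnit_mem_Dset, ?_, not_isCompact_Dset,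
    ⟨extendDset, fun f => hasCompactSupport_extendDset,
      fun g => exists_mem_d00_of_hasCompactSupport, fun f _ g _ h => extendDset_injective h,
      fun f _ g _ => extendDset_add f g, fun f _ g _ => extendDset_mul f g,
      fun c f _ => extendDset_smul c f, fun f _ => norm_extendDset f⟩,
    ⟨extendDset, fun f => tendsto_extendDset,
      fun g => exists_mem_d0_of_tendsto, fun f _ g _ h => extendDset_injective h,
      fun f _ g _ => extendDset_add f g, fun f _ g _ => extendDset_mul f g,
      fun c f _ => extendDset_smul c f, fun f _ => norm_extendDset f⟩⟩
  · rintro ⟨u, hu, h⟩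
    rw [eq_one_of_mul_singletonIndicator fun n => h _ (singletonIndicator_mem_d00 n)] at hu
    exact one_notMem_d0 (d00_subset_d0 hu)
  · rintro ⟨u, hu, h⟩
    rw [eq_one_of_mul_singletonIndicator fun n =>
      h _ (d00_subset_d0 (singletonIndicator_mem_d00 n))] at hu
    exact one_notMem_d0 hu
  · exact denseRange_toDset.mono (range_subset_iff.2 fun n => mem_range_self n)
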